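/- In the warden's game with n dice each having m sides (m ≥ 1, n ≥ 1), from every starting position x ∈ (Fin m)^n there exists a natural number N such that the prisoner can force a win within N moves, i.e., CanWin N x holds. -/

import Mathlib

/-- One move: the rightmost entry is transferred to the far left, becoming `c`,
producing `(c, x₀, …, x_{n−2})`. -/
def shift {α : Type*} {n : ℕ} (c : α) (x : Fin n → α) : Fin n → α :=
  fun i => if _h : (i : ℕ) = 0 then c
    else x ⟨(i : ℕ) - 1, lt_of_le_of_lt (Nat.sub_le _ _) i.isLt⟩

/-- The goal position: every die shows `m - 1`. -/
def goalPos (m n : ℕ) (hm : 1 ≤ m) : Fin n → Fin m :=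
  fun _ => ⟨m - 1, Nat.sub_lt hm Nat.one_pos⟩

/-- `CanWin m n hm hn N x`: the prisoner can force the goal within `N` moves from
position `x`.  It holds iff `x` is the goal, or `N ≥ 1` and both:
(i) for every warden choice `c < x_{n-1}`, `CanWin (N-1)` holds at `(c, x₀, …, x_{n−2})`, and
(ii) there is a prisoner choice `c ≥ x_{n-1}` with `CanWin (N-1)` at `(c, x₀, …, x_{n−2})`. -/
def CanWin (m n : ℕ) (hm : 1 ≤ m) (hn : 1 ≤ n) : ℕ → (Fin n → Fin m) → Prop
  | 0, x => x = goalPos m n hm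
  | N + 1, x => x = goalPos m n hm ∨
      ((∀ c : Fin m, c < x ⟨n - 1, Nat.sub_lt hn Nat.one_pos⟩ →
          CanWin m n hm hn N (shift c x)) ∧
       ∃ c : Fin m, x ⟨n - 1, Nat.sub_lt hn Nat.one_pos⟩ ≤ c ∧
          CanWin m n hm hn N (shift c x))

theorem CanWin.succ {m n : ℕ} {hm : 1 ≤ m} {hn : 1 ≤ n} {N : ℕ} {x : Fin n → Fin m}
    (h : CanWin m n hm hn N x) : CanWin m n hm hn (N + 1) x := by
  induction N generalizing x with
  | zero => exact Or.inl h
  | succ N ih =>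
    rcases h with h | ⟨hw, c, hc, hp⟩
    · exact Or.inl h
    · exact Or.inr ⟨fun d hd => ih (hw d hd), c, hc, ih hp⟩

theorem CanWin.mono {m n : ℕ} {hm : 1 ≤ m} {hn : 1 ≤ n} {N M : ℕ} {x : Fin n → Fin m}
    (hNM : N ≤ M) (h : CanWin m n hm hn N x) : CanWin m n hm hn M x := by
  induction hNM with
  | refl => exact h
  | step _ ih => exact ih.succ

theorem exists_canWin_of_moves {m n : ℕ} {hm : 1 ≤ m} {hn : 1 ≤ n} {x : Fin n → Fin m}
    (hw : ∀ c : Fin m, c < x ⟨n - 1, Nat.sub_lt hn Nat.one_pos⟩ →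
      ∃ N, CanWin m n hm hn N (shift c x))
    (hp : ∃ c : Fin m, x ⟨n - 1, Nat.sub_lt hn Nat.one_pos⟩ ≤ c ∧
      ∃ N, CanWin m n hm hn N (shift c x)) :
    ∃ N, CanWin m n hm hn N x := by
  choose! f hf using hw
  obtain ⟨c, hc, N, hN⟩ := hp
  refine ⟨max N (Finset.univ.sup f) + 1, Or.inr ⟨fun d hd => ?_, c, hc, ?_⟩⟩
  · exact (hf d hd).mono (le_max_of_le_right (Finset.le_sup (Finset.mem_univ d)))
  · exact hN.mono (le_max_left _ _)

theorem shift_snoc {α : Type*} {k : ℕ} (c a : α) (y : Fin k → α) :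
    shift c (Fin.snoc y a : Fin (k + 1) → α) = (Fin.cons c y : Fin (k + 1) → α) := by
  funext i
  refine Fin.cases ?_ (fun j => ?_) i
  · simp [shift]
  · simp [shift, Fin.snoc]

theorem sum_two_pow_rev_lt {m : ℕ} {L : Finset (Fin m)} {r : Fin m} (h : ∀ a ∈ L, r < a) :
    ∑ a ∈ L, 2 ^ (a.rev : ℕ) < 2 ^ (r.rev : ℕ) := by
  have hinj : Set.InjOn (fun a : Fin m => (a.rev : ℕ)) L := fun a _ b _ hab =>
    Fin.rev_injective (Fin.ext hab)
  rw [← Finset.sum_image (f := fun k => 2 ^ k) hinj]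
  refine Nat.geomSum_lt le_rfl fun k hk => ?_
  obtain ⟨a, ha, rfl⟩ := Finset.mem_image.1 hk
  exact Fin.rev_lt_rev.2 (h a ha)

/-- If every `a ∈ L` either exceeds some element of `R` or has its whole upper interval in `R`,
then `L` weighs at most as much as `R`, and equality forces `R` to contain every upper bound
of an element of `L`. -/
theorem sum_two_pow_rev_le {m : ℕ} {L R : Finset (Fin m)}
    (h : ∀ a ∈ L, (∃ c ∈ R, c < a) ∨ ∀ c, a ≤ c → c ∈ R) :
    ∑ a ∈ L, 2 ^ (a.rev : ℕ) ≤ ∑ a ∈ R, 2 ^ (a.rev : ℕ) ∧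
      (∑ a ∈ L, 2 ^ (a.rev : ℕ) = ∑ a ∈ R, 2 ^ (a.rev : ℕ) →
        ∀ a ∈ L, ∀ c, a ≤ c → c ∈ R) := by
  rcases L.eq_empty_or_nonempty with rfl | hL
  · simp
  rcases h _ (L.min'_mem hL) with ⟨r, hr, hlt⟩ | hall
  · have hsum : ∑ a ∈ L, 2 ^ (a.rev : ℕ) < ∑ a ∈ R, 2 ^ (a.rev : ℕ) :=
      (sum_two_pow_rev_lt fun a ha => hlt.trans_le (L.min'_le a ha)).trans_le
        (Finset.single_le_sum (f := fun a : Fin m => 2 ^ (a.rev : ℕ))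
          (fun _ _ => Nat.zero_le _) hr)
    exact ⟨hsum.le, fun he => absurd he hsum.ne⟩
  · exact ⟨Finset.sum_le_sum_of_subset fun a ha => hall a (L.min'_le a ha),
      fun _ a ha c hc => hall c ((L.min'_le a ha).trans hc)⟩

/-- A set of positions in which the warden can stay is closed under every prisoner's move. -/
theorem cons_mem_of_trap {m k : ℕ} (S : Finset (Fin (k + 1) → Fin m))
    (hS : ∀ (y : Fin k → Fin m) (a : Fin m), Fin.snoc y a ∈ S →
      (∃ c < a, Fin.cons c y ∈ S) ∨ ∀ c, a ≤ c → Fin.cons c y ∈ S)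
    (y : Fin k → Fin m) {a c : Fin m} (ha : Fin.snoc y a ∈ S) (hc : a ≤ c) :
    Fin.cons c y ∈ S := by
  classical
  let L (y : Fin k → Fin m) : Finset (Fin m) := {a | Fin.snoc y a ∈ S}
  let R (y : Fin k → Fin m) : Finset (Fin m) := {c | Fin.cons c y ∈ S}
  let v (y : Fin k → Fin m) : ℕ := ∏ i, 2 ^ ((y i).rev : ℕ)
  have key (y) := sum_two_pow_rev_le (L := L y) (R := R y) fun a ha => by
    simpa [L, R, and_comm] using hS y a (by simpa [L] using ha)
  let F (w : Fin (k + 1) → Fin m) : ℕ := if w ∈ S then ∏ i, 2 ^ ((w i).rev : ℕ) else 0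
  have hR : ∑ w, F w = ∑ y, v y * ∑ c ∈ R y, 2 ^ (c.rev : ℕ) := by
    rw [← (Fin.consEquiv fun _ => Fin m).sum_comp, Fintype.sum_prod_type_right]
    refine Finset.sum_congr rfl fun y _ => ?_
    rw [Finset.mul_sum, Finset.sum_filter]
    refine Finset.sum_congr rfl fun c _ => ?_
    simp [F, v, Fin.consEquiv, Fin.prod_univ_succ, mul_comm]
  have hL : ∑ w, F w = ∑ y, v y * ∑ a ∈ L y, 2 ^ (a.rev : ℕ) := by
    rw [← (Fin.snocEquiv fun _ => Fin m).sum_comp, Fintype.sum_prod_type_right]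
    refine Finset.sum_congr rfl fun y _ => ?_
    rw [Finset.mul_sum, Finset.sum_filter]
    refine Finset.sum_congr rfl fun c _ => ?_
    simp [F, v, Fin.snocEquiv, Fin.prod_univ_castSucc]
  have heq := (Finset.sum_eq_sum_iff_of_le
    (fun y _ => Nat.mul_le_mul_left (v y) (key y).1)).1 (hL.symm.trans hR) y (Finset.mem_univ y)
  have hv : 0 < v y := Finset.prod_pos fun _ _ => by positivity
  simpa [R] using (key y).2 (Nat.eq_of_mul_eq_mul_left hv heq) a (by simpa [L] using ha) c hc

theorem iterate_shift_apply {α : Type*} {n : ℕ} (c : α) (x : Fin n → α) (j : ℕ) (i : Fin n)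
    (hi : (i : ℕ) < j) : ((shift c)^[j] x) i = c := by
  induction j generalizing i with
  | zero => omega
  | succ j ih =>
    rw [Function.iterate_succ_apply', shift]
    split_ifs with h
    · rfl
    · exact ih _ (by simp only; omega)

/-- **Basic Win Strategy, Revisited.** In the warden's game with `n ≥ 1` dice each
having `m ≥ 1` sides, from every starting position there is an `N` such that the
prisoner can force a win within `N` moves. -/
theorem warden_dice_win (m n : ℕ) (hm : 1 ≤ m) (hn : 1 ≤ n) (x : Fin n → Fin m) :
    ∃ N : ℕ, CanWin m n hm hn N x := by
  classical
  obtain ⟨k, rfl⟩ : ∃ k, n = k + 1 := ⟨n - 1, by omega⟩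
  by_contra hx
  let S : Finset (Fin (k + 1) → Fin m) := {w | ¬ ∃ N, CanWin m (k + 1) hm hn N w}
  have memS (w) : w ∈ S ↔ ¬ ∃ N, CanWin m (k + 1) hm hn N w := by simp [S]
  have hS (y : Fin k → Fin m) (a : Fin m) (h : Fin.snoc y a ∈ S) :
      (∃ c < a, Fin.cons c y ∈ S) ∨ ∀ c, a ≤ c → Fin.cons c y ∈ S := by
    by_contra! hcon
    obtain ⟨hw, c, hc, hp⟩ := hcon
    have hlast : (Fin.snoc y a : Fin (k + 1) → Fin m)
        ⟨k + 1 - 1, Nat.sub_lt hn Nat.one_pos⟩ = a := Fin.snoc_last (α := fun _ => Fin m) a y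
    refine (memS _).1 h (exists_canWin_of_moves (fun d hd => ?_) ⟨c, hlast.trans_le hc, ?_⟩)
    · rw [shift_snoc]
      exact not_not.1 (mt (memS _).2 (hw d (hd.trans_eq hlast)))
    · rw [shift_snoc]
      exact not_not.1 (mt (memS _).2 hp)
  let t : Fin m := ⟨m - 1, Nat.sub_lt hm Nat.one_pos⟩
  have hstep (w) (hw : w ∈ S) : shift t w ∈ S := by
    rw [← Fin.snoc_init_self w] at hw ⊢
    rw [shift_snoc]
    exact cons_mem_of_trap S hS _ hw (Fin.le_def.2 (Nat.le_sub_one_of_lt (w (Fin.last k)).isLt))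
  have hiter (j : ℕ) : (shift t)^[j] x ∈ S := by
    induction j with
    | zero => exact (memS x).2 hx
    | succ j ih => rw [Function.iterate_succ_apply']; exact hstep _ ih
  refine (memS _).1 (hiter (k + 1)) ⟨0, ?_⟩
  exact funext fun i => iterate_shift_apply t x (k + 1) i i.isLt
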